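/- Let p ≥ 5 be a prime and let M be the Lie ring ⟨a, b | [b,a,b] − [b,a,a,a,a] − [b,a,a,a,a,a], [b,a,a,a,b], p•a, p•b, class 6⟩, i.e., the quotient of the free Lie ring on generators a, b by the Lie ideal generated by the listed elements together with the 7th term of the lower central series. Then the number of isomorphism classes of Lie rings L of cardinality p^8, nilpotent of class exactly 7, with L/L⁷ ≅ M equals 4p² − 3p + 1. -/

import Mathlib

/-- An isomorphism between two Lie rings (Lie algebras over `ℤ`) exists. -/
def IsLieIso (α β : Type*) [LieRing α] [LieRing β] : Prop :=
  ∃ e : α ≃ β, (∀ x y, e (x + y) = e x + e y) ∧ (∀ x y, e ⁅x, y⁆ = ⁅e x, e y⁆)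

/-- A Lie ring is nilpotent of class exactly `c`: `L^{c+1} = 0` and `L^c ≠ 0`. -/
def LieClassEq (α : Type*) [LieRing α] (c : ℕ) : Prop :=
  LieModule.lowerCentralSeries ℤ α α c = ⊥ ∧ LieModule.lowerCentralSeries ℤ α α (c - 1) ≠ ⊥

/-- The free Lie ring on two generators. -/
abbrev FL : Type := FreeLieAlgebra ℤ (Fin 2)

/-- The generator `a`. -/
noncomputable def ga : FL := FreeLieAlgebra.of ℤ 0
/-- The generator `b`. -/
noncomputable def gb : FL := FreeLieAlgebra.of ℤ 1
/-- The left-normed bracket `[b,a,b]`. -/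
noncomputable def bab : FL := ⁅⁅gb, ga⁆, gb⁆
/-- The left-normed bracket `[b,a,a,a]`. -/
noncomputable def ba3 : FL := ⁅⁅⁅gb, ga⁆, ga⁆, ga⁆
/-- The left-normed bracket `[b,a,a,a,b]`. -/
noncomputable def ba3b : FL := ⁅ba3, gb⁆
/-- The left-normed bracket `[b,a,a,a,a]`. -/
noncomputable def ba4 : FL := ⁅ba3, ga⁆
/-- The left-normed bracket `[b,a,a,a,a,a]`. -/
noncomputable def ba5 : FL := ⁅ba4, ga⁆

/-- The quotient of the free Lie ring on `a, b` by the Lie ideal generated by the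
given relator set together with `p•a`, `p•b` and the 7th term of the lower central
series (i.e. the presentation is of class at most 6). -/
abbrev presLie (p : ℕ) (rels : Set FL) : Type :=
  FL ⧸ (LieSubmodule.lieSpan ℤ FL (rels ∪ {p • ga, p • gb}) ⊔
    LieModule.lowerCentralSeries ℤ FL FL 6)

/-- `s` is a Lie ring structure of maximal class 7 on a set of size `p^8` whose
quotient by the 7th term of the lower central series is isomorphic to `β`. -/
def IsMaxClassDescendantOf (p : ℕ) (β : Type*) [LieRing β]
    (s : LieRing (Fin (p ^ 8))) : Prop := by
  letI := s
  exact LieClassEq (Fin (p ^ 8)) 7 ∧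
    IsLieIso (Fin (p ^ 8) ⧸ LieModule.lowerCentralSeries ℤ (Fin (p ^ 8)) (Fin (p ^ 8)) 6) β

/-- Structure constants of a descendant: the values of `[b,a,a,a,a,a,a]`, `[b,a,a,a,a,a,b]`,
`[b,a,b] - [b,a,a,a,a] - [b,a,a,a,a,a]`, `[b,a,a,a,b]`, `p•a` and `p•b` in the last term of the
lower central series, identified with `ZMod p`. -/
@[ext]
structure Params (p : ℕ) where
  l : ZMod p
  m : ZMod p
  g : ZMod p
  d : ZMod p
  al : ZMod p
  be : ZMod p

/-- Coordinates with respect to `a, b, [b,a], …, [b,a,a,a,a,a]` and a generator of the last term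
of the lower central series, before imposing the values of `p•a` and `p•b`. -/
@[ext]
structure Coord {p : ℕ} (θ : Params p) where
  a : ℤ
  b : ℤ
  x2 : ZMod p
  x3 : ZMod p
  x4 : ZMod p
  x5 : ZMod p
  x6 : ZMod p
  c : ZMod p

namespace Coord

variable {p : ℕ} {θ : Params p}

instance : Zero (Coord θ) := ⟨⟨0, 0, 0, 0, 0, 0, 0, 0⟩⟩
instance : Add (Coord θ) := ⟨fun v w => ⟨v.a + w.a, v.b + w.b, v.x2 + w.x2, v.x3 + w.x3,
  v.x4 + w.x4, v.x5 + w.x5, v.x6 + w.x6, v.c + w.c⟩⟩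
instance : Neg (Coord θ) := ⟨fun v => ⟨-v.a, -v.b, -v.x2, -v.x3, -v.x4, -v.x5, -v.x6, -v.c⟩⟩
instance : Sub (Coord θ) := ⟨fun v w => ⟨v.a - w.a, v.b - w.b, v.x2 - w.x2, v.x3 - w.x3,
  v.x4 - w.x4, v.x5 - w.x5, v.x6 - w.x6, v.c - w.c⟩⟩
instance instNSMul : SMul ℕ (Coord θ) := ⟨fun n v => ⟨n • v.a, n • v.b, n • v.x2, n • v.x3,
  n • v.x4, n • v.x5, n • v.x6, n • v.c⟩⟩
instance instZSMul : SMul ℤ (Coord θ) := ⟨fun n v => ⟨n • v.a, n • v.b, n • v.x2, n • v.x3,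
  n • v.x4, n • v.x5, n • v.x6, n • v.c⟩⟩

theorem zero_def : (0 : Coord θ) = ⟨0, 0, 0, 0, 0, 0, 0, 0⟩ := rfl
theorem add_def (v w : Coord θ) : v + w = ⟨v.a + w.a, v.b + w.b, v.x2 + w.x2, v.x3 + w.x3,
  v.x4 + w.x4, v.x5 + w.x5, v.x6 + w.x6, v.c + w.c⟩ := rfl
theorem neg_def (v : Coord θ) :
  -v = ⟨-v.a, -v.b, -v.x2, -v.x3, -v.x4, -v.x5, -v.x6, -v.c⟩ := rfl
theorem sub_def (v w : Coord θ) : v - w = ⟨v.a - w.a, v.b - w.b, v.x2 - w.x2, v.x3 - w.x3,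
  v.x4 - w.x4, v.x5 - w.x5, v.x6 - w.x6, v.c - w.c⟩ := rfl
theorem nsmul_def (n : ℕ) (v : Coord θ) : n • v = ⟨n • v.a, n • v.b, n • v.x2, n • v.x3,
  n • v.x4, n • v.x5, n • v.x6, n • v.c⟩ := rfl
theorem zsmul_def (n : ℤ) (v : Coord θ) : n • v = ⟨n • v.a, n • v.b, n • v.x2, n • v.x3,
  n • v.x4, n • v.x5, n • v.x6, n • v.c⟩ := rfl

/-- The coordinates as a tuple. -/
def toProd (v : Coord θ) :
    ℤ × ℤ × ZMod p × ZMod p × ZMod p × ZMod p × ZMod p × ZMod p :=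
  (v.a, v.b, v.x2, v.x3, v.x4, v.x5, v.x6, v.c)

theorem toProd_injective : Function.Injective (toProd (θ := θ)) := by
  intro v w h
  simp only [toProd, Prod.mk.injEq] at h
  ext <;> simp [h]

instance : AddCommGroup (Coord θ) :=
  toProd_injective.addCommGroup toProd rfl (fun _ _ => rfl) (fun _ => rfl) (fun _ _ => rfl)
    (fun _ _ => rfl) (fun _ _ => rfl)

instance : Bracket (Coord θ) (Coord θ) := ⟨fun v w => ⟨0, 0,
  v.b * w.a - v.a * w.b,
  v.x2 * w.a - v.a * w.x2,
  v.x3 * w.a - v.a * w.x3,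
  v.x4 * w.a - v.a * w.x4 + (v.x2 * w.b - v.b * w.x2),
  v.x5 * w.a - v.a * w.x5 + (v.x2 * w.b - v.b * w.x2) + (v.x3 * w.b - v.b * w.x3),
  θ.l * (v.x6 * w.a - v.a * w.x6) + θ.m * (v.x6 * w.b - v.b * w.x6)
    + θ.g * (v.x2 * w.b - v.b * w.x2) + θ.l * (v.x3 * w.b - v.b * w.x3)
    + θ.d * (v.x4 * w.b - v.b * w.x4) + (θ.l - θ.d) * (v.x3 * w.x2 - v.x2 * w.x3)
    + θ.m * (v.x4 * w.x3 - v.x3 * w.x4) - θ.m * (v.x5 * w.x2 - v.x2 * w.x5)⟩⟩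

theorem lie_def (v w : Coord θ) : ⁅v, w⁆ = ⟨0, 0,
  v.b * w.a - v.a * w.b,
  v.x2 * w.a - v.a * w.x2,
  v.x3 * w.a - v.a * w.x3,
  v.x4 * w.a - v.a * w.x4 + (v.x2 * w.b - v.b * w.x2),
  v.x5 * w.a - v.a * w.x5 + (v.x2 * w.b - v.b * w.x2) + (v.x3 * w.b - v.b * w.x3),
  θ.l * (v.x6 * w.a - v.a * w.x6) + θ.m * (v.x6 * w.b - v.b * w.x6)
    + θ.g * (v.x2 * w.b - v.b * w.x2) + θ.l * (v.x3 * w.b - v.b * w.x3)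
    + θ.d * (v.x4 * w.b - v.b * w.x4) + (θ.l - θ.d) * (v.x3 * w.x2 - v.x2 * w.x3)
    + θ.m * (v.x4 * w.x3 - v.x3 * w.x4) - θ.m * (v.x5 * w.x2 - v.x2 * w.x5)⟩ := rfl

instance : LieRing (Coord θ) where
  add_lie u v w := by
    ext <;> simp only [lie_def, add_def] <;> push_cast <;> ring
  lie_add u v w := by
    ext <;> simp only [lie_def, add_def] <;> push_cast <;> ring
  lie_self v := by
    ext <;> simp only [lie_def, zero_def] <;> ring
  leibniz_lie u v w := by
    ext <;> simp only [lie_def, add_def] <;> push_cast <;> ring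

variable (θ) in
/-- The ideal generated by `p•a - α•c` and `p•b - β•c`. -/
def relIdeal : LieIdeal ℤ (Coord θ) where
  carrier := {v | ∃ s t : ℤ, v = ⟨p * s, p * t, 0, 0, 0, 0, 0, -(θ.al * s + θ.be * t)⟩}
  zero_mem' := ⟨0, 0, by ext <;> simp [zero_def]⟩
  add_mem' := by
    rintro _ _ ⟨s, t, rfl⟩ ⟨s', t', rfl⟩
    refine ⟨s + s', t + t', ?_⟩
    ext <;> simp only [add_def] <;> push_cast <;> ring
  smul_mem' := by
    rintro n _ ⟨s, t, rfl⟩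
    refine ⟨n * s, n * t, ?_⟩
    ext <;> simp only [zsmul_def, zsmul_eq_mul] <;> push_cast <;> ring
  lie_mem := by
    rintro v _ ⟨s, t, rfl⟩
    refine ⟨0, 0, ?_⟩
    ext <;> simp [lie_def]

/-- All coordinates of weight at most `k` vanish. -/
def HasWeight (k : ℕ) (v : Coord θ) : Prop :=
  (1 ≤ k → v.a = 0 ∧ v.b = 0) ∧ (2 ≤ k → v.x2 = 0) ∧ (3 ≤ k → v.x3 = 0) ∧
    (4 ≤ k → v.x4 = 0) ∧ (5 ≤ k → v.x5 = 0) ∧ (6 ≤ k → v.x6 = 0) ∧ (7 ≤ k → v.c = 0)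

theorem HasWeight.lie {k : ℕ} {w : Coord θ} (hw : w.HasWeight k) (v : Coord θ) :
    HasWeight (k + 1) ⁅v, w⁆ := by
  obtain ⟨h1, h2, h3, h4, h5, h6, h7⟩ := hw
  simp only [HasWeight, lie_def]
  refine ⟨?_, ?_, ?_, ?_, ?_, ?_, ?_⟩ <;> intro hk
  · simp
  · simp [h1 (by omega)]
  · simp [h1 (by omega), h2 (by omega)]
  · simp [h1 (by omega), h3 (by omega)]
  · simp [h1 (by omega), h4 (by omega), h2 (by omega)]
  · simp [h1 (by omega), h5 (by omega), h2 (by omega), h3 (by omega)]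
  · simp [h1 (by omega), h5 (by omega), h2 (by omega), h3 (by omega), h4 (by omega),
      h6 (by omega)]

theorem HasWeight.of_succ {k : ℕ} {v : Coord θ} (hv : v.HasWeight (k + 1)) : v.HasWeight k := by
  simp only [HasWeight] at *
  grind

/-- The terms of the filtration of the coordinate ring by weight. -/
def weightIdeal (k : ℕ) : LieIdeal ℤ (Coord θ) where
  carrier := {v | v.HasWeight k}
  zero_mem' := by simp [HasWeight, zero_def]
  add_mem' := by
    intro v w hv hw
    simp only [Set.mem_ofPred_eq, HasWeight, add_def] at *
    grind
  smul_mem' := by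
    intro n v hv
    simp only [Set.mem_ofPred_eq, HasWeight, zsmul_def] at *
    grind
  lie_mem := fun hw => (HasWeight.lie hw _).of_succ

theorem mem_weightIdeal {k : ℕ} {v : Coord θ} : v ∈ weightIdeal k ↔ v.HasWeight k :=
  Iff.rfl

theorem mem_relIdeal {v : Coord θ} : v ∈ relIdeal θ ↔
    ∃ s t : ℤ, v = ⟨p * s, p * t, 0, 0, 0, 0, 0, -(θ.al * s + θ.be * t)⟩ :=
  Iff.rfl

theorem lowerCentralSeries_le_weightIdeal (k : ℕ) :
    LieModule.lowerCentralSeries ℤ (Coord θ) (Coord θ) k ≤ weightIdeal k := by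
  induction k with
  | zero => intro v _; rw [mem_weightIdeal, HasWeight]; omega
  | succ k ih =>
    rw [LieModule.lowerCentralSeries_succ, LieSubmodule.lie_le_iff]
    exact fun v _ w hw => HasWeight.lie (ih hw) v

end Coord

/-- The Lie ring of order `p ^ 8` with structure constants `θ`. -/
abbrev ModelRing {p : ℕ} (θ : Params p) : Type := Coord θ ⧸ Coord.relIdeal θ

namespace ModelRing

variable {p : ℕ} {θ : Params p}

variable (θ) in
/-- The quotient map from the coordinate ring. -/
def proj : Coord θ →ₗ⁅ℤ⁆ ModelRing θ where
  toLinearMap := (LieSubmodule.Quotient.mk' (Coord.relIdeal θ) : Coord θ →ₗ[ℤ] ModelRing θ)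
  map_lie' := rfl

theorem proj_surjective : Function.Surjective (proj θ) :=
  LieSubmodule.Quotient.surjective_mk' _

theorem proj_eq_zero {v : Coord θ} : proj θ v = 0 ↔ v ∈ Coord.relIdeal θ :=
  LieSubmodule.Quotient.mk_eq_zero _

theorem proj_eq_iff {v w : Coord θ} : proj θ v = proj θ w ↔ v - w ∈ Coord.relIdeal θ := by
  rw [← sub_eq_zero, ← map_sub, proj_eq_zero]

theorem eq_of_proj_eq (hp : p ≠ 0) {v w : Coord θ} (ha : v.a = w.a) (hb : v.b = w.b)
    (h : proj θ v = proj θ w) : v = w := by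
  rw [proj_eq_iff, Coord.mem_relIdeal] at h
  obtain ⟨s, t, h⟩ := h
  simp only [Coord.sub_def, Coord.mk.injEq, ha, hb, sub_self, zero_eq_mul, Nat.cast_eq_zero, hp,
    false_or, sub_eq_zero] at h
  obtain ⟨rfl, rfl, h⟩ := h
  simp only [Int.cast_zero, mul_zero, add_zero, neg_zero, sub_eq_zero] at h
  ext <;> simp [ha, hb, h]

theorem card (hp : p.Prime) : Nat.card (ModelRing θ) = p ^ 8 := by
  have := Fact.mk hp
  let f : ZMod p × ZMod p × ZMod p × ZMod p × ZMod p × ZMod p × ZMod p × ZMod p → ModelRing θ :=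
    fun x => proj θ ⟨x.1.val, x.2.1.val, x.2.2.1, x.2.2.2.1, x.2.2.2.2.1, x.2.2.2.2.2.1,
      x.2.2.2.2.2.2.1, x.2.2.2.2.2.2.2⟩
  have hf : Function.Bijective f := by
    constructor
    · rintro ⟨a, b, x2, x3, x4, x5, x6, c⟩ ⟨a', b', y2, y3, y4, y5, y6, c'⟩ h
      have key : a = a' ∧ b = b' := by
        have h' := h
        simp only [f, proj_eq_iff, Coord.mem_relIdeal, Coord.sub_def, Coord.mk.injEq] at h'
        obtain ⟨s, t, h1, h2, -⟩ := h'
        have h1 := congrArg (Int.cast : ℤ → ZMod p) h1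
        have h2 := congrArg (Int.cast : ℤ → ZMod p) h2
        simp only [Int.cast_sub, Int.cast_natCast, ZMod.natCast_zmod_val,
          Int.cast_mul, CharP.cast_eq_zero, zero_mul, sub_eq_zero] at h1 h2
        exact ⟨h1, h2⟩
      obtain ⟨rfl, rfl⟩ := key
      have := eq_of_proj_eq hp.ne_zero (by rfl) (by rfl) (show proj θ _ = proj θ _ from h)
      simp only [Coord.mk.injEq, true_and] at this
      simp [this]
    · intro q
      obtain ⟨v, rfl⟩ := proj_surjective q
      have hdiv : ∀ n : ℤ, ∃ s : ℤ, ((n : ZMod p).val : ℤ) = n + p * s := by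
        intro n
        have : (p : ℤ) ∣ ((n : ZMod p).val : ℤ) - n := by
          rw [← ZMod.intCast_zmod_eq_zero_iff_dvd]; simp
        obtain ⟨s, hs⟩ := this
        exact ⟨s, by linarith⟩
      obtain ⟨s, hs⟩ := hdiv v.a
      obtain ⟨t, ht⟩ := hdiv v.b
      refine ⟨(v.a, v.b, v.x2, v.x3, v.x4, v.x5, v.x6, v.c - (θ.al * s + θ.be * t)), ?_⟩
      simp only [f, proj_eq_iff, Coord.mem_relIdeal]
      refine ⟨s, t, ?_⟩
      ext <;> simp [Coord.sub_def, hs, ht]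
  rw [← Nat.card_congr (Equiv.ofBijective f hf)]
  simp only [Nat.card_prod, Nat.card_zmod]
  ring

variable (θ) in
/-- The elements of the last term of the lower central series. -/
def last : ZMod p →+ ModelRing θ where
  toFun s := proj θ ⟨0, 0, 0, 0, 0, 0, 0, s⟩
  map_zero' := map_zero (proj θ)
  map_add' s t := by rw [← map_add]; simp [Coord.add_def]

theorem last_apply (s : ZMod p) : last θ s = proj θ ⟨0, 0, 0, 0, 0, 0, 0, s⟩ := rfl

theorem last_injective (hp : p ≠ 0) : Function.Injective (last θ) := by
  intro s t h
  have := eq_of_proj_eq hp (by simp) (by simp) h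
  simpa using this

theorem exists_of_mem_lowerCentralSeries {k : ℕ} {q : ModelRing θ}
    (hq : q ∈ LieModule.lowerCentralSeries ℤ (ModelRing θ) (ModelRing θ) k) :
    ∃ v : Coord θ, v.HasWeight k ∧ proj θ v = q := by
  rw [← LieIdeal.lowerCentralSeries_map_eq k proj_surjective] at hq
  obtain ⟨v, rfl⟩ := LieIdeal.mem_map_of_surjective proj_surjective hq
  exact ⟨v, Coord.lowerCentralSeries_le_weightIdeal k v.2, rfl⟩

theorem mem_range_last_of_mem {q : ModelRing θ}
    (hq : q ∈ LieModule.lowerCentralSeries ℤ (ModelRing θ) (ModelRing θ) 6) :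
    ∃ s, last θ s = q := by
  obtain ⟨v, hv, rfl⟩ := exists_of_mem_lowerCentralSeries hq
  refine ⟨v.c, congrArg (proj θ) ?_⟩
  simp only [Coord.HasWeight] at hv
  ext <;> simp [hv]

theorem lowerCentralSeries_seven :
    LieModule.lowerCentralSeries ℤ (ModelRing θ) (ModelRing θ) 7 = ⊥ := by
  rw [eq_bot_iff]
  intro q hq
  obtain ⟨v, hv, rfl⟩ := exists_of_mem_lowerCentralSeries hq
  have : v = 0 := by
    simp only [Coord.HasWeight] at hv
    ext <;> simp [hv, Coord.zero_def]
  simp [this]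

theorem lowerCentralSeries_six_eq_bot (hl : θ.l = 0) (hm : θ.m = 0) :
    LieModule.lowerCentralSeries ℤ (ModelRing θ) (ModelRing θ) 6 = ⊥ := by
  rw [LieModule.lowerCentralSeries_succ, eq_bot_iff, LieSubmodule.lie_le_iff]
  intro r _ q hq
  obtain ⟨v, hv, rfl⟩ := exists_of_mem_lowerCentralSeries hq
  obtain ⟨w, rfl⟩ := proj_surjective r
  have : ⁅w, v⁆ = 0 := by
    simp only [Coord.HasWeight] at hv
    ext <;> simp [hv, Coord.zero_def, Coord.lie_def, hl, hm]
  rw [← LieHom.map_lie, this]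
  simp

end ModelRing

/-- The elements `a`, `b` of a Lie ring satisfy the relations with structure constants `θ`, where
`φ` identifies `ZMod p` with a central subgroup. -/
structure HasPres {p : ℕ} {K : Type*} [LieRing K] (θ : Params p) (φ : ZMod p →+ K) (a b : K) :
    Prop where
  central : ∀ (s : ZMod p) (x : K), ⁅φ s, x⁆ = 0
  smul_a : (p : ℤ) • a = φ θ.al
  smul_b : (p : ℤ) • b = φ θ.be
  lie_bab : ⁅⁅b, a⁆, b⁆ = ⁅⁅⁅⁅b, a⁆, a⁆, a⁆, a⁆ + ⁅⁅⁅⁅⁅b, a⁆, a⁆, a⁆, a⁆, a⁆ + φ θ.g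
  lie_ba3b : ⁅⁅⁅⁅b, a⁆, a⁆, a⁆, b⁆ = φ θ.d
  lie_ba5a : ⁅⁅⁅⁅⁅⁅b, a⁆, a⁆, a⁆, a⁆, a⁆, a⁆ = φ θ.l
  lie_ba5b : ⁅⁅⁅⁅⁅⁅b, a⁆, a⁆, a⁆, a⁆, a⁆, b⁆ = φ θ.m

namespace HasPres

variable {p : ℕ} {K : Type*} [LieRing K] {θ : Params p} {φ : ZMod p →+ K} {a b : K}

theorem exists_addHom {c : K} (hc : (p : ℤ) • c = 0) : ∃ ψ : ZMod p →+ K, ψ 1 = c :=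
  ⟨ZMod.lift p ⟨zmultiplesHom K c, by simpa using hc⟩, by
    have := ZMod.lift_coe p ⟨zmultiplesHom K c, by simpa using hc⟩ 1
    simpa using this⟩

theorem addHom_intCast (ψ : ZMod p →+ K) (n : ℤ) : ψ (n : ZMod p) = n • ψ 1 := by
  rw [← map_zsmul]; simp

theorem addHom_mul_intCast (ψ : ZMod p →+ K) (t : ZMod p) (n : ℤ) :
    ψ (t * (n : ZMod p)) = n • ψ t := by
  rw [← map_zsmul]; simp [mul_comm]

theorem leibniz {x y z : K} : ⁅⁅x, y⁆, z⁆ = ⁅⁅x, z⁆, y⁆ + ⁅x, ⁅y, z⁆⁆ := by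
  rw [lie_lie x y z, ← lie_skew y ⁅x, z⁆]; abel

theorem lie_eq_neg {x y z : K} (h : ⁅x, y⁆ = z) : ⁅y, x⁆ = -z := by
  rw [← h, lie_skew]

theorem exists_hom (h : HasPres θ φ a b) : ∃ f : Coord θ →ₗ⁅ℤ⁆ K,
    f ⟨1, 0, 0, 0, 0, 0, 0, 0⟩ = a ∧ f ⟨0, 1, 0, 0, 0, 0, 0, 0⟩ = b ∧
    (∀ s, f ⟨0, 0, 0, 0, 0, 0, 0, s⟩ = φ s) ∧ (∀ v ∈ Coord.relIdeal θ, f v = 0) := by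
  obtain ⟨hz, ha, hb, h21, h41, h6a, h61⟩ := h
  have hz' : ∀ (s : ZMod p) (x : K), ⁅x, φ s⁆ = 0 := fun s x => by rw [← lie_skew, hz, neg_zero]
  generalize h1a : ⁅b, a⁆ = b2 at *
  generalize h2a : ⁅b2, a⁆ = b3 at *
  generalize h3a : ⁅b3, a⁆ = b4 at *
  generalize h4a : ⁅b4, a⁆ = b5 at *
  generalize h5a : ⁅b5, a⁆ = b6 at *
  have p2 : (p : ℤ) • b2 = 0 := by rw [← h1a, ← zsmul_lie, hb, hz]
  have p3 : (p : ℤ) • b3 = 0 := by rw [← h2a, ← zsmul_lie, p2, zero_lie]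
  have p4 : (p : ℤ) • b4 = 0 := by rw [← h3a, ← zsmul_lie, p3, zero_lie]
  have p5 : (p : ℤ) • b5 = 0 := by rw [← h4a, ← zsmul_lie, p4, zero_lie]
  have p6 : (p : ℤ) • b6 = 0 := by rw [← h5a, ← zsmul_lie, p5, zero_lie]
  have hab : ⁅a, b⁆ = -b2 := lie_eq_neg h1a
  have h31 : ⁅b3, b⁆ = b6 + φ θ.l := by
    rw [← h2a, leibniz, h21, hab]
    simp [h5a, h6a, hz]
  have h32 : ⁅b3, b2⁆ = φ θ.l - φ θ.d := by
    have : ⁅⁅b3, b⁆, a⁆ = ⁅⁅b3, a⁆, b⁆ + ⁅b3, ⁅b, a⁆⁆ := leibniz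
    rw [h31, h3a, h41, h1a, add_lie, h6a, hz, add_zero] at this
    rw [this]; abel
  have step : ∀ {x y x' y' : K}, ⁅x, a⁆ = x' → ⁅y, a⁆ = y' → ⁅⁅x, y⁆, a⁆ = 0 →
      ⁅x', y⁆ = -⁅x, y'⁆ := by
    rintro x y _ _ rfl rfl h
    rw [leibniz] at h
    exact eq_neg_of_add_eq_zero_left h
  have h42 : ⁅b4, b2⁆ = 0 := by
    rw [step h3a h2a (by rw [h32, sub_lie, hz, hz, sub_zero]), lie_self, neg_zero]
  have h51 : ⁅b5, b⁆ = 0 := by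
    rw [step h4a h1a (by rw [h41, hz]), h42, neg_zero]
  have h52 : ⁅b5, b2⁆ = -φ θ.m := by
    have := step h5a h1a (by rw [h51, zero_lie])
    rw [← h61, this, neg_neg]
  have h43 : ⁅b4, b3⁆ = φ θ.m := by
    have := step h4a h2a (by rw [h42, zero_lie])
    rw [h52] at this
    exact (neg_inj.mp this).symm
  have h62 : ⁅b6, b2⁆ = 0 := by
    have : ⁅⁅b6, b⁆, a⁆ = ⁅⁅b6, a⁆, b⁆ + ⁅b6, ⁅b, a⁆⁆ := leibniz
    rw [h61, hz, h6a, hz, h1a, zero_add] at this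
    exact this.symm
  have h53 : ⁅b5, b3⁆ = 0 := by
    have := step h5a h2a (by rw [h52, neg_lie, hz, neg_zero])
    rw [h62] at this
    exact (neg_eq_zero.mp this.symm)
  have h63 : ⁅b6, b3⁆ = 0 := by
    have := step h6a h2a (by rw [h62, zero_lie])
    rw [hz] at this
    exact (neg_eq_zero.mp this.symm)
  have h54 : ⁅b5, b4⁆ = 0 := by
    have := step h5a h3a (by rw [h53, zero_lie])
    rw [h63] at this
    exact (neg_eq_zero.mp this.symm)
  have h64 : ⁅b6, b4⁆ = 0 := by
    have := step h6a h3a (by rw [h63, zero_lie])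
    rw [hz] at this
    exact (neg_eq_zero.mp this.symm)
  have h65 : ⁅b6, b5⁆ = 0 := by
    have := step h6a h4a (by rw [h64, zero_lie])
    rw [hz] at this
    exact (neg_eq_zero.mp this.symm)
  obtain ⟨ψ2, e2⟩ := exists_addHom p2
  obtain ⟨ψ3, e3⟩ := exists_addHom p3
  obtain ⟨ψ4, e4⟩ := exists_addHom p4
  obtain ⟨ψ5, e5⟩ := exists_addHom p5
  obtain ⟨ψ6, e6⟩ := exists_addHom p6
  let f0 : Coord θ →+ K :=
    { toFun := fun v => v.a • a + v.b • b + ψ2 v.x2 + ψ3 v.x3 + ψ4 v.x4 + ψ5 v.x5 + ψ6 v.x6 + φ v.c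
      map_zero' := by simp [Coord.zero_def]
      map_add' := fun v w => by
        simp only [Coord.add_def, map_add, add_smul]; abel }
  have hf0 : ∀ v, f0 v =
    v.a • a + v.b • b + ψ2 v.x2 + ψ3 v.x3 + ψ4 v.x4 + ψ5 v.x5 + ψ6 v.x6 + φ v.c := fun v => rfl
  refine ⟨{ toLinearMap := f0.toIntLinearMap, map_lie' := ?_ }, ?_, ?_, ?_, ?_⟩
  · rintro ⟨a₁, b₁, x2, x3, x4, x5, x6, c₁⟩ ⟨a₂, b₂, y2, y3, y4, y5, y6, c₂⟩
    obtain ⟨x2, rfl⟩ := ZMod.intCast_surjective x2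
    obtain ⟨x3, rfl⟩ := ZMod.intCast_surjective x3
    obtain ⟨x4, rfl⟩ := ZMod.intCast_surjective x4
    obtain ⟨x5, rfl⟩ := ZMod.intCast_surjective x5
    obtain ⟨x6, rfl⟩ := ZMod.intCast_surjective x6
    obtain ⟨y2, rfl⟩ := ZMod.intCast_surjective y2
    obtain ⟨y3, rfl⟩ := ZMod.intCast_surjective y3
    obtain ⟨y4, rfl⟩ := ZMod.intCast_surjective y4
    obtain ⟨y5, rfl⟩ := ZMod.intCast_surjective y5
    obtain ⟨y6, rfl⟩ := ZMod.intCast_surjective y6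
    show f0 _ = ⁅f0 _, f0 _⁆
    simp only [hf0, Coord.lie_def]
    simp only [← Int.cast_mul, ← Int.cast_sub, ← Int.cast_add, map_add, map_sub, sub_mul,
      addHom_mul_intCast]
    simp only [addHom_intCast, e2, e3, e4, e5, e6, add_lie, lie_add, zsmul_lie, lie_zsmul,
      hz, hz', lie_self, hab, h1a, h2a, h3a, h4a, h5a, h6a, h21, h31, h41, h51, h61, h32, h42, h52,
      h62, h43, h53, h63, h54, h64, h65, lie_eq_neg h2a, lie_eq_neg h3a, lie_eq_neg h4a,
      lie_eq_neg h5a, lie_eq_neg h6a, lie_eq_neg h21, lie_eq_neg h31, lie_eq_neg h41,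
      lie_eq_neg h51, lie_eq_neg h61, lie_eq_neg h32, lie_eq_neg h42, lie_eq_neg h52,
      lie_eq_neg h62, lie_eq_neg h43, lie_eq_neg h53, lie_eq_neg h63, lie_eq_neg h54,
      lie_eq_neg h64, lie_eq_neg h65]
    module
  · show f0 _ = _
    simp [hf0]
  · show f0 _ = _
    simp [hf0]
  · intro s
    show f0 _ = _
    simp [hf0]
  · intro v hv
    obtain ⟨s, t, rfl⟩ := hv
    show f0 _ = _
    have e1 : ((p : ℤ) * s) • a = s • φ θ.al := by rw [mul_comm, mul_smul, ha]
    have e2 : ((p : ℤ) * t) • b = t • φ θ.be := by rw [mul_comm, mul_smul, hb]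
    simp only [hf0, map_zero, map_neg, map_add, addHom_mul_intCast, e1, e2]
    module

theorem exists_modelHom (h : HasPres θ φ a b) : ∃ f : ModelRing θ →ₗ⁅ℤ⁆ K,
    f (ModelRing.proj θ ⟨1, 0, 0, 0, 0, 0, 0, 0⟩) = a ∧
    f (ModelRing.proj θ ⟨0, 1, 0, 0, 0, 0, 0, 0⟩) = b ∧
    ∀ s, f (ModelRing.last θ s) = φ s := by
  obtain ⟨f, fa, fb, fc, hf⟩ := h.exists_hom
  refine ⟨{ toLinearMap := Submodule.liftQ (Coord.relIdeal θ).toSubmodule (f : Coord θ →ₗ[ℤ] K) hf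
            map_lie' := ?_ }, fa, fb, fc⟩
  intro q r
  obtain ⟨v, rfl⟩ := ModelRing.proj_surjective q
  obtain ⟨w, rfl⟩ := ModelRing.proj_surjective r
  exact f.map_lie v w

end HasPres

namespace ModelRing

variable {p : ℕ} {θ : Params p}

theorem comp_mulLeft_apply (u s : ZMod p) :
    (last θ).comp (AddMonoidHom.mulLeft u) s = last θ (u * s) := rfl

theorem hasPres_subst {θ' : Params p} (Y : ℤ) (k3 k5 u : ZMod p)
    (hl : u * θ'.l = θ.l + Y * θ.m) (hm : u * θ'.m = θ.m)
    (hg : u * θ'.g = θ.g + 2 * k5 * θ.m + 2 * (θ.d - θ.l) * k3 + k3 ^ 2 * θ.m - 2 * θ.l * Y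
      - 2 * θ.m * Y ^ 2 - θ.d * Y)
    (hd : u * θ'.d = θ.d + 2 * k3 * θ.m + 2 * θ.m * Y)
    (hal : u * θ'.al = θ.al + Y * θ.be) (hbe : u * θ'.be = θ.be) :
    HasPres θ' ((last θ).comp (AddMonoidHom.mulLeft u)) (proj θ ⟨1, Y, 0, 0, 0, 0, 0, 0⟩)
      (proj θ ⟨0, 1, 0, k3, 0, k5, 0, 0⟩) where
  central s x := by
    obtain ⟨v, rfl⟩ := proj_surjective x
    simp only [comp_mulLeft_apply, last_apply, ← LieHom.map_lie]
    convert map_zero (proj θ)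
    simp [Coord.lie_def, Coord.zero_def]
  smul_a := by
    simp only [comp_mulLeft_apply, last_apply, ← map_zsmul, hal,
      proj_eq_iff, Coord.mem_relIdeal]
    refine ⟨1, Y, ?_⟩
    ext <;> simp [Coord.sub_def, Coord.nsmul_def]
    ring
  smul_b := by
    simp only [comp_mulLeft_apply, last_apply, ← map_zsmul, hbe,
      proj_eq_iff, Coord.mem_relIdeal]
    refine ⟨0, 1, ?_⟩
    ext <;> simp [Coord.sub_def, Coord.nsmul_def]
  lie_bab := by
    simp only [comp_mulLeft_apply, last_apply, hg,
      ← LieHom.map_lie, ← map_add]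
    congr 1
    ext <;> simp [Coord.lie_def, Coord.add_def]
    ring
  lie_ba3b := by
    simp only [comp_mulLeft_apply, last_apply, hd,
      ← LieHom.map_lie]
    congr 1
    ext <;> simp [Coord.lie_def]
    ring
  lie_ba5a := by
    simp only [comp_mulLeft_apply, last_apply, hl,
      ← LieHom.map_lie]
    congr 1
    ext <;> simp [Coord.lie_def]
    ring
  lie_ba5b := by
    simp only [comp_mulLeft_apply, last_apply, hm,
      ← LieHom.map_lie]
    congr 1
    ext <;> simp [Coord.lie_def]

theorem nonempty_equiv_subst (hp : p.Prime) {θ' : Params p} (y k3 k5 u : ZMod p) (hu : u ≠ 0)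
    (hl : u * θ'.l = θ.l + y * θ.m) (hm : u * θ'.m = θ.m)
    (hg : u * θ'.g = θ.g + 2 * k5 * θ.m + 2 * (θ.d - θ.l) * k3 + k3 ^ 2 * θ.m - 2 * θ.l * y
      - 2 * θ.m * y ^ 2 - θ.d * y)
    (hd : u * θ'.d = θ.d + 2 * k3 * θ.m + 2 * θ.m * y)
    (hal : u * θ'.al = θ.al + y * θ.be) (hbe : u * θ'.be = θ.be) :
    Nonempty (ModelRing θ' ≃ₗ⁅ℤ⁆ ModelRing θ) := by
  have := Fact.mk hp
  obtain ⟨Y, rfl⟩ := ZMod.intCast_surjective y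
  obtain ⟨f, fa, fb, fc⟩ := (hasPres_subst Y k3 k5 u hl hm hg hd hal hbe).exists_modelHom
  have hinj : Function.Injective f := by
    rw [injective_iff_map_eq_zero]
    intro q hq
    obtain ⟨⟨a, b, x2, x3, x4, x5, x6, c⟩, rfl⟩ := proj_surjective q
    obtain ⟨x2, rfl⟩ := ZMod.intCast_surjective x2
    obtain ⟨x3, rfl⟩ := ZMod.intCast_surjective x3
    obtain ⟨x4, rfl⟩ := ZMod.intCast_surjective x4
    obtain ⟨x5, rfl⟩ := ZMod.intCast_surjective x5
    obtain ⟨x6, rfl⟩ := ZMod.intCast_surjective x6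
    let ea : Coord θ' := ⟨1, 0, 0, 0, 0, 0, 0, 0⟩
    let eb : Coord θ' := ⟨0, 1, 0, 0, 0, 0, 0, 0⟩
    have hv : (⟨a, b, x2, x3, x4, x5, x6, c⟩ : Coord θ') = a • ea + b • eb + x2 • ⁅eb, ea⁆
        + x3 • ⁅⁅eb, ea⁆, ea⁆ + x4 • ⁅⁅⁅eb, ea⁆, ea⁆, ea⁆ + x5 • ⁅⁅⁅⁅eb, ea⁆, ea⁆, ea⁆, ea⁆
        + x6 • ⁅⁅⁅⁅⁅eb, ea⁆, ea⁆, ea⁆, ea⁆, ea⁆ + ⟨0, 0, 0, 0, 0, 0, 0, c⟩ := by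
      ext <;> simp [Coord.lie_def, Coord.add_def, Coord.zsmul_def, ea, eb]
    rw [hv] at hq
    simp only [map_add, map_zsmul, LieHom.map_lie] at hq
    rw [fa, fb, ← last_apply, fc] at hq
    simp only [comp_mulLeft_apply, last_apply] at hq
    simp only [← LieHom.map_lie, ← map_zsmul, ← map_add] at hq
    rw [proj_eq_zero, Coord.mem_relIdeal] at hq
    obtain ⟨s, t, hq⟩ := hq
    simp [Coord.lie_def, Coord.add_def, Coord.zsmul_def] at hq
    obtain ⟨rfl, hb, h2, h3, h4, h5, h6, hc⟩ := hq
    obtain rfl : b = p * (t - s * Y) := by linear_combination hb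
    simp only [Int.cast_mul, Int.cast_natCast, CharP.cast_eq_zero, zero_mul, zero_add] at h3 h5
    simp only [h2, h3, zero_mul, zero_add, add_zero] at h4 h5
    simp only [h2, h3, h4, zero_mul, zero_add] at h6
    simp only [h2, h3, h4, h5, zero_mul, zero_add] at hc
    rw [proj_eq_zero, Coord.mem_relIdeal]
    refine ⟨s, t - s * Y, ?_⟩
    ext <;> simp only [h2, h3, h4, h5, h6]
    apply mul_left_cancel₀ hu
    push_cast
    linear_combination hc + s * hal + (t - s * Y) * hbe
  have hc : Nat.card (ModelRing θ') = Nat.card (ModelRing θ) := by rw [card hp, card hp]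
  have : Finite (ModelRing θ) :=
    Nat.finite_of_card_ne_zero (by rw [card hp]; exact pow_ne_zero _ hp.ne_zero)
  exact ⟨LieEquiv.ofBijective f ((Nat.bijective_iff_injective_and_card f).2 ⟨hinj, hc⟩)⟩

end ModelRing

theorem Coord.HasWeight.lie_left {p k : ℕ} {θ : Params p} {v : Coord θ} (hv : v.HasWeight k)
    (w : Coord θ) : Coord.HasWeight (k + 1) ⁅v, w⁆ := by
  rw [← lie_skew]
  exact (Coord.weightIdeal (k + 1)).neg_mem (hv.lie w)

theorem Coord.HasWeight.eq_of_seven {p : ℕ} {θ : Params p} {v : Coord θ} (hv : v.HasWeight 7) :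
    v = 0 := by
  simp only [Coord.HasWeight] at hv
  ext <;> simp [hv, Coord.zero_def]

theorem Coord.lie_lie_lie_lie_lie_lie {p : ℕ} {θ : Params p} (v w t : Coord θ) :
    ⁅⁅⁅⁅⁅⁅w, v⁆, v⁆, v⁆, v⁆, v⁆, t⁆ =
      ⟨0, 0, 0, 0, 0, 0, 0, Coord.c ⁅⁅⁅⁅⁅⁅w, v⁆, v⁆, v⁆, v⁆, v⁆, t⁆⟩ := by
  have h1 : Coord.HasWeight 1 ⁅w, v⁆ := by simp [Coord.HasWeight, Coord.lie_def]
  have h5 := (((h1.lie_left v).lie_left v).lie_left v).lie_left v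
  generalize ⁅⁅⁅⁅⁅w, v⁆, v⁆, v⁆, v⁆, v⁆ = u at *
  simp only [Coord.HasWeight] at h5
  ext <;> simp [Coord.lie_def, h5]

namespace ModelRing

variable {p : ℕ} {θ θ' : Params p}

theorem exists_scalar (hp : p.Prime) {φ : ZMod p →+ ModelRing θ} (hφ : Function.Injective φ)
    {t c : ZMod p} (ht : t ≠ 0) (h : φ t = last θ c) : ∃ u ≠ 0, ∀ s, φ s = last θ (u * s) := by
  have := Fact.mk hp
  have key : ∀ s, φ s = last θ (c * t⁻¹ * s) := by
    intro s
    obtain ⟨n, hn⟩ := ZMod.intCast_surjective (t⁻¹ * s)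
    have : s = t * n := by rw [hn, mul_inv_cancel_left₀ ht]
    rw [mul_assoc, ← hn, HasPres.addHom_mul_intCast, ← h, ← HasPres.addHom_mul_intCast, ← this]
  refine ⟨c * t⁻¹, fun h0 => ?_, key⟩
  refine ht (hφ ?_)
  rw [key, h0, zero_mul, map_zero, map_zero]

theorem coord_equations (hp : p.Prime) {φ : ZMod p →+ ModelRing θ} (hφ : Function.Injective φ)
    (h' : θ'.l ≠ 0 ∨ θ'.m ≠ 0) {v w : Coord θ} (h : HasPres θ' φ (proj θ v) (proj θ w)) :
    ∃ u ≠ 0,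
      ⁅⁅w, v⁆, w⁆ = ⁅⁅⁅⁅w, v⁆, v⁆, v⁆, v⁆ + ⁅⁅⁅⁅⁅w, v⁆, v⁆, v⁆, v⁆, v⁆
        + ⟨0, 0, 0, 0, 0, 0, 0, u * θ'.g⟩ ∧
      ⁅⁅⁅⁅w, v⁆, v⁆, v⁆, w⁆ = ⟨0, 0, 0, 0, 0, 0, 0, u * θ'.d⟩ ∧
      ⁅⁅⁅⁅⁅⁅w, v⁆, v⁆, v⁆, v⁆, v⁆, v⁆ = ⟨0, 0, 0, 0, 0, 0, 0, u * θ'.l⟩ ∧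
      ⁅⁅⁅⁅⁅⁅w, v⁆, v⁆, v⁆, v⁆, v⁆, w⁆ = ⟨0, 0, 0, 0, 0, 0, 0, u * θ'.m⟩ ∧
      u * θ'.al = v.a * θ.al + v.b * θ.be ∧ u * θ'.be = w.a * θ.al + w.b * θ.be := by
  obtain ⟨-, ha, hb, hg, hd, hl, hm⟩ := h
  simp only [← LieHom.map_lie, ← map_add, ← map_zsmul] at ha hb hg hd hl hm
  obtain ⟨u, hu, hφu⟩ : ∃ u ≠ 0, ∀ s, φ s = last θ (u * s) := by
    rcases h' with h' | h'
    · refine exists_scalar hp hφ (c := Coord.c ⁅⁅⁅⁅⁅⁅w, v⁆, v⁆, v⁆, v⁆, v⁆, v⁆) h' ?_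
      rw [← hl, last_apply]
      exact congrArg _ (Coord.lie_lie_lie_lie_lie_lie v w _)
    · refine exists_scalar hp hφ (c := Coord.c ⁅⁅⁅⁅⁅⁅w, v⁆, v⁆, v⁆, v⁆, v⁆, w⁆) h' ?_
      rw [← hm, last_apply]
      exact congrArg _ (Coord.lie_lie_lie_lie_lie_lie v w _)
  have hsmul : ∀ {v : Coord θ} {s : ZMod p}, proj θ ((p : ℤ) • v) = φ s →
      u * s = v.a * θ.al + v.b * θ.be := by
    intro v s h
    rw [hφu, last_apply, proj_eq_iff, Coord.mem_relIdeal] at h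
    obtain ⟨n, k, h⟩ := h
    simp only [Coord.sub_def, Coord.zsmul_def, smul_eq_mul, sub_zero, Coord.mk.injEq,
      mul_eq_mul_left_iff, Nat.cast_eq_zero, hp.ne_zero, or_false] at h
    obtain ⟨rfl, rfl, -, -, -, -, -, h⟩ := h
    simp only [zsmul_eq_mul, Int.cast_natCast, CharP.cast_eq_zero, zero_mul, zero_sub] at h
    linear_combination -h
  simp only [hφu, last_apply, ← map_add] at hg hd hl hm
  exact ⟨u, hu, eq_of_proj_eq hp.ne_zero rfl rfl hg, eq_of_proj_eq hp.ne_zero rfl rfl hd,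
    eq_of_proj_eq hp.ne_zero rfl rfl hl, eq_of_proj_eq hp.ne_zero rfl rfl hm,
    hsmul ha, hsmul hb⟩

theorem leading_coeffs (hp : p.Prime) {v w : Coord θ} {g : ZMod p}
    (hg : ⁅⁅w, v⁆, w⁆ = ⁅⁅⁅⁅w, v⁆, v⁆, v⁆, v⁆ + ⁅⁅⁅⁅⁅w, v⁆, v⁆, v⁆, v⁆, v⁆
      + ⟨0, 0, 0, 0, 0, 0, 0, g⟩)
    (hne : ¬ (⁅⁅⁅⁅⁅⁅w, v⁆, v⁆, v⁆, v⁆, v⁆, v⁆ = 0 ∧ ⁅⁅⁅⁅⁅⁅w, v⁆, v⁆, v⁆, v⁆, v⁆, w⁆ = 0)) :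
    (v.a : ZMod p) = 1 ∧ (w.a : ZMod p) = 0 ∧ (w.b : ZMod p) = 1 := by
  have := Fact.mk hp
  have hD : (w.b * v.a - w.a * v.b : ZMod p) ≠ 0 := by
    intro hD
    have h2 : Coord.HasWeight 2 ⁅w, v⁆ := by
      simp [Coord.HasWeight, Coord.lie_def, hD]
    have h6 := (((h2.lie_left v).lie_left v).lie_left v).lie_left v
    exact hne ⟨(h6.lie_left v).eq_of_seven, (h6.lie_left w).eq_of_seven⟩
  have e3 := congrArg Coord.x3 hg
  simp [Coord.lie_def, Coord.add_def, hD] at e3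
  have e5 := congrArg Coord.x5 hg
  have e6 := congrArg Coord.x6 hg
  simp [Coord.lie_def, Coord.add_def, e3] at e5 e6 hD
  obtain ⟨hwb, hva⟩ := hD
  generalize (v.a : ZMod p) = x at *
  generalize (w.b : ZMod p) = z at *
  have h1 : z = x ^ 3 := by
    refine mul_left_cancel₀ (mul_ne_zero hwb hva) ?_
    linear_combination e5
  have h2 : x = 1 := by
    refine mul_left_cancel₀ (mul_ne_zero hwb (pow_ne_zero 4 hva)) ?_
    linear_combination e5 - e6 + w.x2 * x * h1
  exact ⟨h2, e3, by rw [h1, h2, one_pow]⟩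

theorem invariant_equations (hp : p.Prime) {φ : ZMod p →+ ModelRing θ}
    (hφ : Function.Injective φ) (h' : θ'.l ≠ 0 ∨ θ'.m ≠ 0) {a b : ModelRing θ}
    (h : HasPres θ' φ a b) :
    ∃ u ≠ 0, ∃ y, u * θ'.l = θ.l + y * θ.m ∧ u * θ'.m = θ.m ∧
      u * θ'.al = θ.al + y * θ.be ∧ u * θ'.be = θ.be ∧
      (θ.m = 0 → u * θ'.d = θ.d ∧ (θ.l = θ.d → u * θ'.g = θ.g - 3 * θ.l * y)) := by
  have := Fact.mk hp
  obtain ⟨v, rfl⟩ := proj_surjective a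
  obtain ⟨w, rfl⟩ := proj_surjective b
  obtain ⟨u, hu, hg, hd, hl, hm, hal, hbe⟩ := coord_equations hp hφ h' h
  obtain ⟨hva, hwa, hwb⟩ := leading_coeffs hp hg (by
    rintro ⟨h1, h2⟩
    rw [hl] at h1
    rw [hm] at h2
    have h1 := congrArg Coord.c h1
    have h2 := congrArg Coord.c h2
    simp only [Coord.zero_def, mul_eq_zero, hu, false_or] at h1 h2
    tauto)
  rw [hva, one_mul] at hal
  rw [hwa, hwb, one_mul, zero_mul, zero_add] at hbe
  have hl := congrArg Coord.c hl
  have hm := congrArg Coord.c hm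
  have hd := congrArg Coord.c hd
  have hg := congrArg Coord.c hg
  refine ⟨u, hu, v.b, ?_, ?_, hal, hbe, fun hm0 => ⟨?_, fun hld => ?_⟩⟩
  · simp only [Coord.lie_def, hva, hwa, hwb, zero_mul, mul_one, sub_zero] at hl
    linear_combination -hl
  · simp only [Coord.lie_def, hva, hwa, hwb, Int.cast_zero, mul_zero, zero_mul,
      mul_one, one_mul, sub_zero, zero_add, add_zero, sub_self] at hm
    linear_combination -hm
  · simp only [Coord.lie_def, hva, hwa, hwb, hm0, Int.cast_zero, mul_zero, zero_mul,
      mul_one, one_mul, sub_zero, zero_add, add_zero, sub_self] at hd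
    linear_combination -hd
  · simp only [Coord.lie_def, Coord.add_def, hva, hwa, hwb, hm0, ← hld, Int.cast_zero,
      mul_zero, zero_mul,
      mul_one, one_mul, sub_zero, zero_add, add_zero, sub_self] at hg
    linear_combination -hg

end ModelRing

/-- The representatives of the isomorphism classes of descendants. -/
def Params.IsNormal {p : ℕ} (θ : Params p) : Prop :=
  θ.g = 0 ∧ ((θ.l = 0 ∧ θ.m = 1 ∧ θ.d = 0) ∨
    (θ.l = 1 ∧ θ.m = 0 ∧ (θ.d = 1 ∨ θ.al = 0 ∨ θ.be = 0)))

theorem Params.IsNormal.ne_zero {p : ℕ} (hp : p.Prime) {θ : Params p} (hθ : θ.IsNormal) :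
    θ.l ≠ 0 ∨ θ.m ≠ 0 := by
  have := Fact.mk hp
  rcases hθ.2 with ⟨-, h, -⟩ | ⟨h, -⟩ <;> simp [h]

theorem HasPres.map {p : ℕ} {K K' : Type*} [LieRing K] [LieRing K'] {θ : Params p}
    {φ : ZMod p →+ K} {a b : K} (h : HasPres θ φ a b) (e : K ≃ₗ⁅ℤ⁆ K') :
    HasPres θ ((e : K →ₗ⁅ℤ⁆ K').toLinearMap.toAddMonoidHom.comp φ) (e a) (e b) where
  central s x := by
    obtain ⟨y, rfl⟩ := e.surjective x
    exact (e.map_lie _ _).symm.trans (by rw [h.central, map_zero])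
  smul_a := (map_zsmul e _ _).symm.trans (congrArg e h.smul_a)
  smul_b := (map_zsmul e _ _).symm.trans (congrArg e h.smul_b)
  lie_bab := by
    simp only [← e.map_lie, h.lie_bab, map_add]
    rfl
  lie_ba3b := by
    simp only [← e.map_lie, h.lie_ba3b]
    rfl
  lie_ba5a := by
    simp only [← e.map_lie, h.lie_ba5a]
    rfl
  lie_ba5b := by
    simp only [← e.map_lie, h.lie_ba5b]
    rfl

namespace ModelRing

variable {p : ℕ} {θ θ' : Params p}

theorem hasPres (θ : Params p) : HasPres θ (last θ) (proj θ ⟨1, 0, 0, 0, 0, 0, 0, 0⟩)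
    (proj θ ⟨0, 1, 0, 0, 0, 0, 0, 0⟩) := by
  have h := hasPres_subst (θ := θ) (θ' := θ) 0 0 0 1 (by simp) (by simp) (by simp) (by simp)
    (by simp) (by simp)
  have h1 : (last θ).comp (AddMonoidHom.mulLeft 1) = last θ := by
    ext; simp
  rwa [h1] at h

theorem six_ne_zero (hp : p.Prime) (h5 : 5 ≤ p) : (6 : ZMod p) ≠ 0 := by
  intro h
  have h : ((2 * 3 : ℕ) : ZMod p) = 0 := by exact_mod_cast h
  rw [ZMod.natCast_eq_zero_iff, hp.dvd_mul] at h
  rcases h with h | h <;> have := Nat.le_of_dvd (by norm_num) h <;> omega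

theorem eq_of_isNormal (hp : p.Prime) (h5 : 5 ≤ p) (hθ : θ.IsNormal) (hθ' : θ'.IsNormal)
    (e : ModelRing θ' ≃ₗ⁅ℤ⁆ ModelRing θ) : θ = θ' := by
  have := Fact.mk hp
  have h3 : (3 : ZMod p) ≠ 0 := fun h => six_ne_zero hp h5 (by linear_combination 2 * h)
  obtain ⟨u, hu, y, hl, hm, hal, hbe, h⟩ := invariant_equations hp
    (e.injective.comp (last_injective hp.ne_zero)) (hθ'.ne_zero hp) ((hasPres θ').map e)
  obtain ⟨l, m, g, d, al, be⟩ := θ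
  obtain ⟨l', m', g', d', al', be'⟩ := θ'
  simp only [Params.IsNormal] at hθ hθ'
  simp only at hl hm hal hbe h
  obtain ⟨rfl, ⟨rfl, rfl, rfl⟩ | ⟨rfl, rfl, hd⟩⟩ := hθ <;>
  obtain ⟨rfl, ⟨rfl, rfl, rfl⟩ | ⟨rfl, rfl, hd'⟩⟩ := hθ'
  · obtain rfl : u = 1 := by simpa using hm
    obtain rfl : y = 0 := by simpa using hl.symm
    simp_all
  · simp at hm
  · simp [hu] at hm
  · obtain rfl : u = 1 := by simpa using hl
    obtain ⟨h1, h2⟩ := h rfl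
    simp only [one_mul] at h1 h2 hal hbe
    subst h1 hbe
    by_cases hd1 : (1 : ZMod p) = d'
    · obtain rfl : y = 0 := by simpa [h3] using h2 hd1
      simp [hal]
    · rcases hd with hd | hd | hd
      · exact absurd hd.symm hd1
      · rcases hd' with hd' | hd' | hd'
        · exact absurd hd'.symm hd1
        · simp [hd, hd']
        · simp [hal, hd']
      · simp [hal, hd]

theorem exists_isNormal (hp : p.Prime) (h5 : 5 ≤ p) (hθ : θ.l ≠ 0 ∨ θ.m ≠ 0) :
    ∃ θ' : Params p, θ'.IsNormal ∧ Nonempty (ModelRing θ' ≃ₗ⁅ℤ⁆ ModelRing θ) := by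
  have := Fact.mk hp
  have h6 := six_ne_zero hp h5
  have h2 : (2 : ZMod p) ≠ 0 := fun h => h6 (by linear_combination 3 * h)
  have h3 : (3 : ZMod p) ≠ 0 := fun h => h6 (by linear_combination 2 * h)
  by_cases hm : θ.m = 0
  · have hl : θ.l ≠ 0 := by tauto
    by_cases hd : θ.d = θ.l
    · refine ⟨⟨1, 0, 0, 1, _, _⟩, by simp [Params.IsNormal],
        nonempty_equiv_subst hp (θ.g / (3 * θ.l)) 0 0 θ.l hl ?_ ?_ ?_ ?_
          (mul_div_cancel₀ _ hl) (mul_div_cancel₀ _ hl)⟩ <;>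
        simp only [hm, hd] <;> field_simp <;> ring
    · have hd' : θ.d - θ.l ≠ 0 := sub_ne_zero.mpr hd
      obtain ⟨y, hy⟩ : ∃ y, θ.al + y * θ.be = 0 ∨ θ.be = 0 := by
        by_cases hbe : θ.be = 0
        · exact ⟨0, .inr hbe⟩
        · exact ⟨-θ.al / θ.be, .inl (by field_simp; ring)⟩
      refine ⟨⟨1, 0, 0, θ.d / θ.l, (θ.al + y * θ.be) / θ.l, θ.be / θ.l⟩, ?_,
        nonempty_equiv_subst hp y (-(θ.g - 2 * θ.l * y - θ.d * y) / (2 * (θ.d - θ.l)))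
          0 θ.l hl ?_ ?_ ?_ ?_ (mul_div_cancel₀ _ hl) (mul_div_cancel₀ _ hl)⟩
      · simp only [Params.IsNormal, div_eq_zero_iff]
        tauto
      all_goals
        simp only [hm]
        field_simp
        ring
  · refine ⟨⟨0, 1, 0, 0, _, _⟩, by simp [Params.IsNormal],
        nonempty_equiv_subst hp (-θ.l / θ.m) (-(θ.d - 2 * θ.l) / (2 * θ.m))
          (-(θ.g + 2 * (θ.d - θ.l) * (-(θ.d - 2 * θ.l) / (2 * θ.m))
            + (-(θ.d - 2 * θ.l) / (2 * θ.m)) ^ 2 * θ.m - 2 * θ.l * (-θ.l / θ.m)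
            - 2 * θ.m * (-θ.l / θ.m) ^ 2 - θ.d * (-θ.l / θ.m)) / (2 * θ.m)) θ.m hm ?_ ?_ ?_ ?_
          (mul_div_cancel₀ _ hm) (mul_div_cancel₀ _ hm)⟩ <;> field_simp <;> ring

end ModelRing

/-- Parameters for the representatives: the families `(l, m) = (0, 1)`, `(l, m, d) = (1, 0, 1)` and
`(l, m) = (1, 0)` with `d ≠ 1`. -/
def Params.ofSum {p : ℕ} :
    (ZMod p × ZMod p) ⊕ (ZMod p × ZMod p) ⊕
      ({d : ZMod p // d ≠ 1} × (ZMod p ⊕ {be : ZMod p // be ≠ 0})) → Params p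
  | .inl (al, be) => ⟨0, 1, 0, 0, al, be⟩
  | .inr (.inl (al, be)) => ⟨1, 0, 0, 1, al, be⟩
  | .inr (.inr (d, .inl al)) => ⟨1, 0, 0, d, al, 0⟩
  | .inr (.inr (d, .inr be)) => ⟨1, 0, 0, d, 0, be⟩

theorem Params.ofSum_injective {p : ℕ} (hp : p.Prime) :
    Function.Injective (Params.ofSum (p := p)) := by
  have := Fact.mk hp
  rintro (⟨al, be⟩ | ⟨al, be⟩ | ⟨⟨d, hd⟩, al | ⟨be, hbe⟩⟩)
    (⟨al', be'⟩ | ⟨al', be'⟩ | ⟨⟨d', hd'⟩, al' | ⟨be', hbe'⟩⟩) h <;>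
  simp only [Params.ofSum, Params.mk.injEq] at h <;> grind

theorem Params.range_ofSum {p : ℕ} :
    Set.range (Params.ofSum (p := p)) = {θ | θ.IsNormal} := by
  ext ⟨l, m, g, d, al, be⟩
  simp only [Set.mem_range, Set.mem_ofPred_eq]
  constructor
  · rintro ⟨⟨al, be⟩ | ⟨al, be⟩ | ⟨⟨d, hd⟩, al | ⟨be, hbe⟩⟩, h⟩ <;>
      simp only [Params.ofSum, Params.mk.injEq] at h <;> simp [Params.IsNormal, ← h]
  · simp only [Params.IsNormal]
    rintro ⟨rfl, ⟨rfl, rfl, rfl⟩ | ⟨rfl, rfl, h⟩⟩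
    · exact ⟨.inl (al, be), rfl⟩
    · by_cases hd : d = 1
      · exact ⟨.inr (.inl (al, be)), by rw [hd]; rfl⟩
      · by_cases hbe : be = 0
        · exact ⟨.inr (.inr (⟨d, hd⟩, .inl al)), by rw [hbe]; rfl⟩
        · obtain rfl : al = 0 := by tauto
          exact ⟨.inr (.inr (⟨d, hd⟩, .inr ⟨be, hbe⟩)), rfl⟩

theorem Params.card_isNormal {p : ℕ} (hp : p.Prime) :
    Nat.card {θ : Params p // θ.IsNormal} = 4 * p ^ 2 - 3 * p + 1 := by
  have := Fact.mk hp
  have h : Nat.card {θ : Params p // θ.IsNormal} = p * p + (p * p + (p - 1) * (p + (p - 1))) := by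
    change Nat.card ({θ : Params p | θ.IsNormal} : Set (Params p)) = _
    rw [← Params.range_ofSum, Nat.card_range_of_injective (Params.ofSum_injective hp)]
    simp
  rw [h]
  obtain ⟨q, rfl⟩ : ∃ q, p = q + 1 := ⟨p - 1, by have := hp.pos; omega⟩
  have : 3 * (q + 1) ≤ 4 * (q + 1) ^ 2 := by nlinarith
  zify [this]
  push_cast [Nat.add_sub_cancel]
  ring

section Quotient

variable {K K' : Type*} [LieRing K] [LieRing K']

theorem lie_mem_lowerCentralSeries_succ {k : ℕ} {x : K}
    (hx : x ∈ LieModule.lowerCentralSeries ℤ K K k) (y : K) :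
    ⁅x, y⁆ ∈ LieModule.lowerCentralSeries ℤ K K (k + 1) := by
  rw [← lie_skew, LieModule.lowerCentralSeries_succ]
  exact neg_mem (LieSubmodule.lie_mem_lie (LieSubmodule.mem_top y) hx)

theorem lie_six_mem_lowerCentralSeries (x x1 x2 x3 x4 x5 x6 : K) :
    ⁅⁅⁅⁅⁅⁅x, x1⁆, x2⁆, x3⁆, x4⁆, x5⁆, x6⁆ ∈ LieModule.lowerCentralSeries ℤ K K 6 := by
  iterate 6 refine lie_mem_lowerCentralSeries_succ ?_ _
  simp

/-- The quotient map by an ideal of a Lie ring. -/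
def LieIdeal.quotHom (I : LieIdeal ℤ K) : K →ₗ⁅ℤ⁆ K ⧸ I where
  toLinearMap := (LieSubmodule.Quotient.mk' I : K →ₗ[ℤ] K ⧸ I)
  map_lie' := rfl

theorem LieIdeal.quotHom_surjective (I : LieIdeal ℤ K) : Function.Surjective I.quotHom :=
  LieSubmodule.Quotient.surjective_mk' _

theorem LieIdeal.quotHom_eq_zero {I : LieIdeal ℤ K} {x : K} : I.quotHom x = 0 ↔ x ∈ I :=
  LieSubmodule.Quotient.mk_eq_zero _

theorem LieIdeal.exists_quotLift {I : LieIdeal ℤ K} (f : K →ₗ⁅ℤ⁆ K') (hf : ∀ x ∈ I, f x = 0) :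
    ∃ g : K ⧸ I →ₗ⁅ℤ⁆ K', ∀ x, g (I.quotHom x) = f x := by
  refine ⟨{ toLinearMap := Submodule.liftQ I.toSubmodule (f : K →ₗ[ℤ] K') hf
            map_lie' := ?_ }, fun _ => rfl⟩
  intro q r
  obtain ⟨v, rfl⟩ := I.quotHom_surjective q
  obtain ⟨w, rfl⟩ := I.quotHom_surjective r
  exact f.map_lie v w

theorem LieIdeal.card_eq_card_quotient_mul_card (I : LieIdeal ℤ K) :
    Nat.card K = Nat.card (K ⧸ I) * Nat.card I :=
  AddSubgroup.card_eq_card_quotient_mul_card_addSubgroup I.toSubmodule.toAddSubgroup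

theorem map_mem_lowerCentralSeries (f : K →ₗ⁅ℤ⁆ K') {k : ℕ} {x : K}
    (hx : x ∈ LieModule.lowerCentralSeries ℤ K K k) :
    f x ∈ LieModule.lowerCentralSeries ℤ K' K' k :=
  LieIdeal.map_lowerCentralSeries_le k (f := f) (LieIdeal.mem_map hx)

theorem LieIdeal.lowerCentralSeries_quotient_eq_bot {k : ℕ} :
    LieModule.lowerCentralSeries ℤ (K ⧸ LieModule.lowerCentralSeries ℤ K K k)
      (K ⧸ LieModule.lowerCentralSeries ℤ K K k) k = ⊥ := by
  rw [eq_bot_iff, ← LieIdeal.lowerCentralSeries_map_eq k (LieIdeal.quotHom_surjective _)]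
  intro q hq
  obtain ⟨⟨v, hv⟩, rfl⟩ := LieIdeal.mem_map_of_surjective (LieIdeal.quotHom_surjective _) hq
  exact LieIdeal.quotHom_eq_zero.2 hv

end Quotient

/-- The Lie ring 7.648. -/
abbrev BaseRing (p : ℕ) : Type := presLie p {bab - ba4 - ba5, ba3b}

namespace BaseRing

variable {p : ℕ} {K : Type*} [LieRing K]

variable (p) in
/-- The quotient map from the free Lie ring. -/
noncomputable def mk : FL →ₗ⁅ℤ⁆ BaseRing p := LieIdeal.quotHom _

theorem mk_surjective : Function.Surjective (mk p) := LieIdeal.quotHom_surjective _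

theorem mk_eq_zero_of_mem {x : FL}
    (hx : x ∈ ({bab - ba4 - ba5, ba3b} ∪ {p • ga, p • gb} : Set FL)) : mk p x = 0 :=
  LieIdeal.quotHom_eq_zero.2 (LieSubmodule.mem_sup_left (LieSubmodule.subset_lieSpan hx))

theorem mk_eq_zero_of_mem_lowerCentralSeries {x : FL}
    (hx : x ∈ LieModule.lowerCentralSeries ℤ FL FL 6) : mk p x = 0 :=
  LieIdeal.quotHom_eq_zero.2 (LieSubmodule.mem_sup_right hx)

theorem hasPres : HasPres (⟨0, 0, 0, 0, 0, 0⟩ : Params p) 0 (mk p ga) (mk p gb) where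
  central s x := zero_lie _
  smul_a := by
    have := mk_eq_zero_of_mem (p := p) (x := p • ga) (by simp)
    simpa using this
  smul_b := by
    have := mk_eq_zero_of_mem (p := p) (x := p • gb) (by simp)
    simpa using this
  lie_bab := by
    have := mk_eq_zero_of_mem (p := p) (x := bab - ba4 - ba5) (by simp)
    simp only [bab, ba5, ba4, ba3, map_sub, LieHom.map_lie] at this
    rw [AddMonoidHom.zero_apply, add_zero, ← sub_eq_zero, ← sub_sub, this]
  lie_ba3b := by
    have := mk_eq_zero_of_mem (p := p) (x := ba3b) (by simp)
    simpa only [ba3b, ba3, LieHom.map_lie, AddMonoidHom.zero_apply] using this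
  lie_ba5a := by
    simp only [← LieHom.map_lie, AddMonoidHom.zero_apply]
    exact mk_eq_zero_of_mem_lowerCentralSeries (lie_six_mem_lowerCentralSeries _ _ _ _ _ _ _)
  lie_ba5b := by
    simp only [← LieHom.map_lie, AddMonoidHom.zero_apply]
    exact mk_eq_zero_of_mem_lowerCentralSeries (lie_six_mem_lowerCentralSeries _ _ _ _ _ _ _)

theorem exists_lift (f : FL →ₗ⁅ℤ⁆ K) (hK : LieModule.lowerCentralSeries ℤ K K 6 = ⊥)
    (h1 : f (bab - ba4 - ba5) = 0) (h2 : f ba3b = 0) (ha : f (p • ga) = 0)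
    (hb : f (p • gb) = 0) : ∃ g : BaseRing p →ₗ⁅ℤ⁆ K, ∀ x, g (mk p x) = f x := by
  refine LieIdeal.exists_quotLift f fun x hx => ?_
  rw [← LieHom.mem_ker]
  refine (sup_le ?_ ?_ : _ ≤ f.ker) hx
  · rw [LieSubmodule.lieSpan_le]
    rintro y ((rfl | rfl) | (rfl | rfl)) <;> rw [SetLike.mem_coe, LieHom.mem_ker] <;> assumption
  · intro y hy
    have := map_mem_lowerCentralSeries f hy
    rw [hK] at this
    simpa [LieHom.mem_ker] using this

theorem exists_hom (x y : K) : ∃ g : FL →ₗ⁅ℤ⁆ K, g ga = x ∧ g gb = y :=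
  ⟨FreeLieAlgebra.lift ℤ ![x, y], FreeLieAlgebra.lift_of_apply ![x, y] 0,
    FreeLieAlgebra.lift_of_apply ![x, y] 1⟩

theorem hom_ext {f g : FL →ₗ⁅ℤ⁆ K} (ha : f ga = g ga) (hb : f gb = g gb) : f = g := by
  ext i
  fin_cases i
  · exact ha
  · exact hb

theorem exists_surjective_of_zero :
    ∃ f : ModelRing (⟨0, 0, 0, 0, 0, 0⟩ : Params p) →ₗ⁅ℤ⁆ BaseRing p,
    Function.Surjective f ∧ ∀ s, f (ModelRing.last _ s) = 0 := by
  obtain ⟨f, fa, fb, fc⟩ := (hasPres (p := p)).exists_modelHom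
  refine ⟨f, fun q => ?_, fc⟩
  obtain ⟨x, rfl⟩ := mk_surjective q
  obtain ⟨g, g1, g2⟩ := exists_hom
    (ModelRing.proj (⟨0, 0, 0, 0, 0, 0⟩ : Params p) ⟨1, 0, 0, 0, 0, 0, 0, 0⟩)
    (ModelRing.proj _ ⟨0, 1, 0, 0, 0, 0, 0, 0⟩)
  have h : f.comp g = mk p := hom_ext ((congrArg f g1).trans fa) ((congrArg f g2).trans fb)
  exact ⟨g x, LieHom.congr_fun h x⟩

theorem card_le (hp : p.Prime) : Finite (BaseRing p) ∧ Nat.card (BaseRing p) ≤ p ^ 7 := by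
  obtain ⟨f, hf, hl⟩ := exists_surjective_of_zero (p := p)
  have hfin : Finite (ModelRing (⟨0, 0, 0, 0, 0, 0⟩ : Params p)) :=
    Nat.finite_of_card_ne_zero (by rw [ModelRing.card hp]; exact pow_ne_zero _ hp.ne_zero)
  refine ⟨Finite.of_surjective f hf, ?_⟩
  have h1 := f.ker.card_eq_card_quotient_mul_card
  have h2 : p ≤ Nat.card f.ker := by
    refine (Nat.card_zmod p).symm.le.trans ?_
    exact Nat.card_le_card_of_injective (fun s => ⟨ModelRing.last _ s, f.mem_ker.2 (hl s)⟩)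
      fun s t h => ModelRing.last_injective hp.ne_zero (congrArg Subtype.val h)
  obtain ⟨g, hg⟩ := LieIdeal.exists_quotLift f fun x hx => f.mem_ker.1 hx
  have := Finite.of_surjective _ f.ker.quotHom_surjective
  have h3 : Nat.card (BaseRing p) ≤ Nat.card (ModelRing (⟨0, 0, 0, 0, 0, 0⟩ : Params p) ⧸ f.ker) :=
    Nat.card_le_card_of_surjective g fun q => by
      obtain ⟨x, rfl⟩ := hf q
      exact ⟨_, hg x⟩
  rw [ModelRing.card hp] at h1
  have h4 := Nat.mul_le_mul h3 h2
  rw [← h1, pow_succ] at h4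
  exact Nat.le_of_mul_le_mul_right h4 hp.pos

end BaseRing

namespace ModelRing

variable {p : ℕ} {θ : Params p}

theorem last_mem (hp : p.Prime) (hθ : θ.l ≠ 0 ∨ θ.m ≠ 0) (s : ZMod p) :
    last θ s ∈ LieModule.lowerCentralSeries ℤ (ModelRing θ) (ModelRing θ) 6 := by
  have := Fact.mk hp
  have key : ∀ t : ZMod p, t ≠ 0 →
      last θ t ∈ LieModule.lowerCentralSeries ℤ (ModelRing θ) (ModelRing θ) 6 →
      last θ s ∈ LieModule.lowerCentralSeries ℤ (ModelRing θ) (ModelRing θ) 6 := by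
    intro t ht h
    obtain ⟨n, hn⟩ := ZMod.intCast_surjective (t⁻¹ * s)
    have : s = t * n := by rw [hn, mul_inv_cancel_left₀ ht]
    rw [this, HasPres.addHom_mul_intCast]
    exact zsmul_mem h n
  rcases hθ with h | h
  · refine key _ h ?_
    rw [← (hasPres θ).lie_ba5a]
    exact lie_six_mem_lowerCentralSeries _ _ _ _ _ _ _
  · refine key _ h ?_
    rw [← (hasPres θ).lie_ba5b]
    exact lie_six_mem_lowerCentralSeries _ _ _ _ _ _ _

theorem card_lowerCentralSeries_six (hp : p.Prime) (hθ : θ.l ≠ 0 ∨ θ.m ≠ 0) :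
    Nat.card (LieModule.lowerCentralSeries ℤ (ModelRing θ) (ModelRing θ) 6) = p := by
  refine (Nat.card_eq_of_bijective (fun s => ⟨last θ s, last_mem hp hθ s⟩)
    ⟨fun s t h => last_injective hp.ne_zero (congrArg Subtype.val h), ?_⟩).symm.trans
    (Nat.card_zmod p)
  rintro ⟨q, hq⟩
  obtain ⟨s, rfl⟩ := mem_range_last_of_mem hq
  exact ⟨s, rfl⟩

theorem lieClassEq (hp : p.Prime) (hθ : θ.l ≠ 0 ∨ θ.m ≠ 0) : LieClassEq (ModelRing θ) 7 := by
  refine ⟨lowerCentralSeries_seven, fun h => ?_⟩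
  have := Fact.mk hp
  have h1 := last_mem hp hθ 1
  rw [h, LieSubmodule.mem_bot] at h1
  exact one_ne_zero (last_injective hp.ne_zero (h1.trans (map_zero _).symm))

theorem card_quotient (hp : p.Prime) (hθ : θ.l ≠ 0 ∨ θ.m ≠ 0) :
    Nat.card (ModelRing θ ⧸ LieModule.lowerCentralSeries ℤ (ModelRing θ) (ModelRing θ) 6)
      = p ^ 7 := by
  have h := LieIdeal.card_eq_card_quotient_mul_card
    (LieModule.lowerCentralSeries ℤ (ModelRing θ) (ModelRing θ) 6)
  rw [card hp, card_lowerCentralSeries_six hp hθ, pow_succ] at h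
  exact (Nat.eq_of_mul_eq_mul_right hp.pos h).symm

theorem exists_freeHom (hp : p.Prime) (hθ : θ.l ≠ 0 ∨ θ.m ≠ 0) : ∃ f : FL →ₗ⁅ℤ⁆
    ModelRing θ ⧸ LieModule.lowerCentralSeries ℤ (ModelRing θ) (ModelRing θ) 6,
    Function.Surjective f ∧ f (bab - ba4 - ba5) = 0 ∧ f ba3b = 0 ∧ f (p • ga) = 0 ∧
      f (p • gb) = 0 := by
  set π := LieIdeal.quotHom (LieModule.lowerCentralSeries ℤ (ModelRing θ) (ModelRing θ) 6) with hπ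
  have hlast : ∀ s, π (last θ s) = 0 := fun s => LieIdeal.quotHom_eq_zero.2 (last_mem hp hθ s)
  have h := hasPres θ
  obtain ⟨g, hga, hgb⟩ := BaseRing.exists_hom (proj θ ⟨1, 0, 0, 0, 0, 0, 0, 0⟩)
    (proj θ ⟨0, 1, 0, 0, 0, 0, 0, 0⟩)
  refine ⟨π.comp g, ?_, ?_, ?_, ?_, ?_⟩
  · intro r
    obtain ⟨q, rfl⟩ := LieIdeal.quotHom_surjective _ r
    obtain ⟨⟨a, b, x2, x3, x4, x5, x6, c⟩, rfl⟩ := proj_surjective q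
    obtain ⟨x2, rfl⟩ := ZMod.intCast_surjective x2
    obtain ⟨x3, rfl⟩ := ZMod.intCast_surjective x3
    obtain ⟨x4, rfl⟩ := ZMod.intCast_surjective x4
    obtain ⟨x5, rfl⟩ := ZMod.intCast_surjective x5
    obtain ⟨x6, rfl⟩ := ZMod.intCast_surjective x6
    refine ⟨a • ga + b • gb + x2 • ⁅gb, ga⁆ + x3 • ⁅⁅gb, ga⁆, ga⁆ + x4 • ⁅⁅⁅gb, ga⁆, ga⁆, ga⁆
      + x5 • ⁅⁅⁅⁅gb, ga⁆, ga⁆, ga⁆, ga⁆ + x6 • ⁅⁅⁅⁅⁅gb, ga⁆, ga⁆, ga⁆, ga⁆, ga⁆, ?_⟩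
    rw [LieHom.comp_apply, ← sub_eq_zero, ← hπ, ← map_sub, ← neg_eq_zero, ← map_neg, ← hlast c]
    congr 1
    simp only [map_add, map_zsmul, LieHom.map_lie, hga, hgb, last_apply]
    simp only [← LieHom.map_lie, ← map_zsmul, ← map_add, ← map_sub, ← map_neg]
    congr 1
    ext <;> simp [Coord.lie_def, Coord.add_def, Coord.zsmul_def, Coord.sub_def, Coord.neg_def]
  · rw [LieHom.comp_apply, ← hlast θ.g]
    congr 1
    simp only [bab, ba5, ba4, ba3, map_sub, LieHom.map_lie, hga, hgb, h.lie_bab]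
    abel
  · rw [LieHom.comp_apply, ← hlast θ.d]
    congr 1
    simp only [ba3b, ba3, LieHom.map_lie, hga, hgb, h.lie_ba3b]
  · rw [LieHom.comp_apply, ← hlast θ.al, map_nsmul, hga, ← h.smul_a, natCast_zsmul]
  · rw [LieHom.comp_apply, ← hlast θ.be, map_nsmul, hgb, ← h.smul_b, natCast_zsmul]

theorem nonempty_baseRing_equiv_and_card (hp : p.Prime) (hθ : θ.l ≠ 0 ∨ θ.m ≠ 0) :
    Nonempty (BaseRing p ≃ₗ⁅ℤ⁆
      ModelRing θ ⧸ LieModule.lowerCentralSeries ℤ (ModelRing θ) (ModelRing θ) 6) ∧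
    Nat.card (BaseRing p) = p ^ 7 := by
  obtain ⟨f, hf, h1, h2, ha, hb⟩ := exists_freeHom hp hθ
  obtain ⟨g, hg⟩ := BaseRing.exists_lift f LieIdeal.lowerCentralSeries_quotient_eq_bot h1 h2 ha hb
  obtain ⟨hfin, hle⟩ := BaseRing.card_le hp
  have hgs : Function.Surjective g := fun q => by
    obtain ⟨x, rfl⟩ := hf q
    exact ⟨_, hg x⟩
  have hcard : Nat.card (BaseRing p) = p ^ 7 :=
    le_antisymm hle ((card_quotient hp hθ).symm.le.trans (Nat.card_le_card_of_surjective g hgs))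
  have hbij : Function.Bijective g := (Nat.bijective_iff_surjective_and_card g).2
    ⟨hgs, hcard.trans (card_quotient hp hθ).symm⟩
  exact ⟨⟨LieEquiv.ofBijective g hbij⟩, hcard⟩

end ModelRing

theorem BaseRing.card {p : ℕ} (hp : p.Prime) : Nat.card (BaseRing p) = p ^ 7 := by
  have := Fact.mk hp
  exact (ModelRing.nonempty_baseRing_equiv_and_card (θ := ⟨1, 0, 0, 0, 0, 0⟩) hp (by simp)).2

section Descendant

variable {p : ℕ} {L : Type*} [LieRing L]

theorem exists_addHom_range_eq (hp : p.Prime) {H : AddSubgroup L} (hH : Nat.card H = p) :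
    ∃ φ : ZMod p →+ L, ∀ x, x ∈ H ↔ ∃ s, φ s = x := by
  subst hH
  have := Fact.mk hp
  have := isAddCyclic_of_prime_card (α := H) rfl
  let ψ := zmodAddCyclicAddEquiv (G := H) inferInstance
  refine ⟨H.subtype.comp ψ.toAddMonoidHom, fun x => ⟨fun hx => ⟨ψ.symm ⟨x, hx⟩, by simp⟩, ?_⟩⟩
  rintro ⟨s, rfl⟩
  exact (ψ s).2

theorem exists_hasPres (hp : p.Prime) (hcard : Nat.card L = p ^ 8)
    (h7 : LieModule.lowerCentralSeries ℤ L L 7 = ⊥)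
    (e : (L ⧸ LieModule.lowerCentralSeries ℤ L L 6) ≃ₗ⁅ℤ⁆ BaseRing p) :
    ∃ (θ : Params p) (φ : ZMod p →+ L) (a b : L), HasPres θ φ a b ∧
      ∀ x : L, ∃ w : FL, ∀ f : FL →ₗ⁅ℤ⁆ L, f ga = a → f gb = b → ∃ s, x = f w + φ s := by
  let I : LieIdeal ℤ L := LieModule.lowerCentralSeries ℤ L L 6
  have hI : Nat.card I.toSubmodule.toAddSubgroup = p := by
    have h := LieIdeal.card_eq_card_quotient_mul_card I
    rw [hcard, Nat.card_eq_of_bijective e e.bijective, BaseRing.card hp, pow_succ] at h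
    exact (Nat.eq_of_mul_eq_mul_left (pow_pos hp.pos 7) h).symm
  obtain ⟨φ, hφ⟩ := exists_addHom_range_eq hp hI
  let π : L →ₗ⁅ℤ⁆ BaseRing p := (e : (L ⧸ I) →ₗ⁅ℤ⁆ BaseRing p).comp I.quotHom
  have hπ : ∀ {x}, π x = 0 → ∃ s, φ s = x := fun {x} hx =>
    (hφ x).1 (LieIdeal.quotHom_eq_zero.1 ((map_eq_zero_iff e e.injective).1 hx))
  have hπs : Function.Surjective π := e.surjective.comp I.quotHom_surjective
  obtain ⟨a, ha⟩ := hπs (BaseRing.mk p ga)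
  obtain ⟨b, hb⟩ := hπs (BaseRing.mk p gb)
  have hM := BaseRing.hasPres (p := p)
  rw [← ha, ← hb] at hM
  obtain ⟨-, h1, h2, h3, h4, h5, h6⟩ := hM
  simp only [← LieHom.map_lie, ← map_zsmul, ← map_add, AddMonoidHom.zero_apply, add_zero]
    at h1 h2 h3 h4 h5 h6
  rw [← sub_eq_zero, ← map_sub] at h3
  obtain ⟨al, h1⟩ := hπ h1
  obtain ⟨be, h2⟩ := hπ h2
  obtain ⟨g, h3⟩ := hπ h3
  obtain ⟨d, h4⟩ := hπ h4
  obtain ⟨l, h5⟩ := hπ h5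
  obtain ⟨m, h6⟩ := hπ h6
  refine ⟨⟨l, m, g, d, al, be⟩, φ, a, b, ⟨fun s x => ?_, h1.symm, h2.symm, ?_, h4.symm, h5.symm,
    h6.symm⟩, fun x => ?_⟩
  · have := lie_mem_lowerCentralSeries_succ (k := 6) ((hφ (φ s)).2 ⟨s, rfl⟩) x
    rwa [h7, LieSubmodule.mem_bot] at this
  · rw [h3, add_sub_cancel]
  · obtain ⟨w, hw⟩ := BaseRing.mk_surjective (π x)
    refine ⟨w, fun f fa fb => ?_⟩
    have : π.comp f = BaseRing.mk p :=
      BaseRing.hom_ext ((congrArg π fa).trans ha) ((congrArg π fb).trans hb)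
    obtain ⟨s, hs⟩ := hπ (x := x - f w) (by
      rw [map_sub, ← hw, ← this, LieHom.comp_apply, sub_self])
    exact ⟨s, by rw [hs, add_sub_cancel]⟩

theorem exists_equiv_modelRing (hp : p.Prime) (hcard : Nat.card L = p ^ 8) (hL : LieClassEq L 7)
    (e : (L ⧸ LieModule.lowerCentralSeries ℤ L L 6) ≃ₗ⁅ℤ⁆ BaseRing p) :
    ∃ θ : Params p, (θ.l ≠ 0 ∨ θ.m ≠ 0) ∧ Nonempty (ModelRing θ ≃ₗ⁅ℤ⁆ L) := by
  obtain ⟨θ, φ, a, b, h, hgen⟩ := exists_hasPres hp hcard hL.1 e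
  obtain ⟨f, fa, fb, fc⟩ := h.exists_modelHom
  obtain ⟨g, hga, hgb⟩ := BaseRing.exists_hom (ModelRing.proj θ ⟨1, 0, 0, 0, 0, 0, 0, 0⟩)
    (ModelRing.proj θ ⟨0, 1, 0, 0, 0, 0, 0, 0⟩)
  have hf : Function.Surjective f := by
    intro x
    obtain ⟨w, hw⟩ := hgen x
    obtain ⟨s, hs⟩ := hw (f.comp g) ((congrArg f hga).trans fa) ((congrArg f hgb).trans fb)
    exact ⟨g w + ModelRing.last θ s, by rw [hs, map_add, fc, LieHom.comp_apply]⟩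
  refine ⟨θ, ?_, ⟨LieEquiv.ofBijective f ?_⟩⟩
  · by_contra! hθ
    refine hL.2 ?_
    rw [eq_bot_iff]
    intro x hx
    rw [← LieIdeal.lowerCentralSeries_map_eq _ hf] at hx
    obtain ⟨⟨q, hq⟩, rfl⟩ := LieIdeal.mem_map_of_surjective hf hx
    rw [show 7 - 1 = 6 from rfl, ModelRing.lowerCentralSeries_six_eq_bot hθ.1 hθ.2,
      LieSubmodule.mem_bot] at hq
    simp [hq]
  · have : Finite (ModelRing θ) :=
      Nat.finite_of_card_ne_zero (by rw [ModelRing.card hp]; exact pow_ne_zero _ hp.ne_zero)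
    exact (Nat.bijective_iff_surjective_and_card f).2
      ⟨hf, (ModelRing.card hp).trans hcard.symm⟩

end Descendant

theorem isLieIso_iff {α β : Type*} [LieRing α] [LieRing β] :
    IsLieIso α β ↔ Nonempty (α ≃ₗ⁅ℤ⁆ β) := by
  constructor
  · rintro ⟨e, hadd, hlie⟩
    exact ⟨{ (AddEquiv.mk e hadd).toIntLinearEquiv with map_lie' := hlie _ _ }⟩
  · rintro ⟨e⟩
    exact ⟨e.toLinearEquiv.toEquiv, map_add e, fun x y => e.map_lie x y⟩

theorem IsLieIso.symm {α β : Type*} [LieRing α] [LieRing β] (h : IsLieIso α β) :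
    IsLieIso β α := by
  rw [isLieIso_iff] at *
  exact h.map LieEquiv.symm

theorem IsLieIso.trans {α β γ : Type*} [LieRing α] [LieRing β] [LieRing γ] (h : IsLieIso α β)
    (h' : IsLieIso β γ) : IsLieIso α γ := by
  rw [isLieIso_iff] at *
  obtain ⟨e⟩ := h
  exact h'.map e.trans

theorem exists_lieRing_isLieIso {α β : Type*} [LieRing α] (e : β ≃ α) :
    ∃ _ : LieRing β, IsLieIso α β := by
  let s := e.lieRing
  refine ⟨s, e.symm, fun x y => ?_, fun x y => ?_⟩
  · rw [Equiv.symm_apply_eq]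
    simp [Equiv.add_def]
  · rw [Equiv.symm_apply_eq]
    simp [Equiv.bracket_def]

namespace LieEquiv

variable {K K' : Type*} [LieRing K] [LieRing K']

theorem mem_lowerCentralSeries_iff (e : K ≃ₗ⁅ℤ⁆ K') {k : ℕ} {x : K} :
    e x ∈ LieModule.lowerCentralSeries ℤ K' K' k ↔ x ∈ LieModule.lowerCentralSeries ℤ K K k := by
  refine ⟨fun h => ?_, map_mem_lowerCentralSeries (e : K →ₗ⁅ℤ⁆ K')⟩
  have := map_mem_lowerCentralSeries (e.symm : K' →ₗ⁅ℤ⁆ K) h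
  simpa using this

theorem lowerCentralSeries_eq_bot_iff (e : K ≃ₗ⁅ℤ⁆ K') {k : ℕ} :
    LieModule.lowerCentralSeries ℤ K K k = ⊥ ↔ LieModule.lowerCentralSeries ℤ K' K' k = ⊥ := by
  simp only [eq_bot_iff, SetLike.le_def, LieSubmodule.mem_bot]
  constructor
  · intro h y hy
    obtain ⟨x, rfl⟩ := e.surjective y
    rw [h (e.mem_lowerCentralSeries_iff.1 hy), map_zero]
  · intro h x hx
    exact (map_eq_zero_iff e e.injective).1 (h (e.mem_lowerCentralSeries_iff.2 hx))

theorem nonempty_quotient_lowerCentralSeries (e : K ≃ₗ⁅ℤ⁆ K') (k : ℕ) :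
    Nonempty ((K ⧸ LieModule.lowerCentralSeries ℤ K K k) ≃ₗ⁅ℤ⁆
      (K' ⧸ LieModule.lowerCentralSeries ℤ K' K' k)) := by
  let π := LieIdeal.quotHom (LieModule.lowerCentralSeries ℤ K' K' k)
  obtain ⟨g, hg⟩ := LieIdeal.exists_quotLift (I := LieModule.lowerCentralSeries ℤ K K k)
    (π.comp (e : K →ₗ⁅ℤ⁆ K'))
    fun x hx => LieIdeal.quotHom_eq_zero.2 (e.mem_lowerCentralSeries_iff.2 hx)
  refine ⟨LieEquiv.ofBijective g ⟨?_, fun y => ?_⟩⟩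
  · rw [injective_iff_map_eq_zero]
    intro q hq
    obtain ⟨x, rfl⟩ := LieIdeal.quotHom_surjective _ q
    rw [hg] at hq
    exact LieIdeal.quotHom_eq_zero.2
      (e.mem_lowerCentralSeries_iff.1 (LieIdeal.quotHom_eq_zero.1 hq))
  · obtain ⟨y, rfl⟩ := LieIdeal.quotHom_surjective _ y
    obtain ⟨x, rfl⟩ := e.surjective y
    exact ⟨_, hg x⟩

end LieEquiv

theorem descendant_iff {p : ℕ} (hp : p.Prime) (h5 : 5 ≤ p) {L : Type*} [LieRing L]
    (hcard : Nat.card L = p ^ 8) :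
    LieClassEq L 7 ∧ IsLieIso (L ⧸ LieModule.lowerCentralSeries ℤ L L 6) (BaseRing p) ↔
      ∃ θ : Params p, θ.IsNormal ∧ IsLieIso (ModelRing θ) L := by
  simp only [isLieIso_iff]
  constructor
  · rintro ⟨hL, ⟨e⟩⟩
    obtain ⟨θ, hθ, ⟨f⟩⟩ := exists_equiv_modelRing hp hcard hL e
    obtain ⟨θ', hθ', ⟨f'⟩⟩ := ModelRing.exists_isNormal hp h5 hθ
    exact ⟨θ', hθ', ⟨f'.trans f⟩⟩
  · rintro ⟨θ, hθ, ⟨f⟩⟩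
    have hθ := hθ.ne_zero hp
    have hM := ModelRing.lieClassEq hp hθ
    obtain ⟨e⟩ := (ModelRing.nonempty_baseRing_equiv_and_card hp hθ).1
    obtain ⟨e'⟩ := f.symm.nonempty_quotient_lowerCentralSeries 6
    exact ⟨⟨f.lowerCentralSeries_eq_bot_iff.1 hM.1,
      fun h => hM.2 (f.lowerCentralSeries_eq_bot_iff.2 h)⟩, ⟨e'.trans e.symm⟩⟩

/-- The Lie ring 7.648 : `⟨a,b | [b,a,b]-[b,a,a,a,a]-[b,a,a,a,a,a], [b,a,a,a,b],
pa, pb, class 6⟩` has `4p² - 3p + 1` descendants of order `p^8` (of maximal class 7). -/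
theorem descendants_of_7_648 (p : ℕ) (hp : p.Prime) (h5 : 5 ≤ p) :
    Nat.card (Quot (fun s t :
        {s : LieRing (Fin (p ^ 8)) //
          IsMaxClassDescendantOf p (presLie p {bab - ba4 - ba5, ba3b}) s} =>
      @IsLieIso _ _ s.1 t.1)) = 4 * p ^ 2 - 3 * p + 1 := by
  have hcard : Nat.card (Fin (p ^ 8)) = p ^ 8 := Nat.card_fin _
  have hiff : ∀ s : LieRing (Fin (p ^ 8)),
      IsMaxClassDescendantOf p (presLie p {bab - ba4 - ba5, ba3b}) s ↔
        ∃ θ : Params p, θ.IsNormal ∧ IsLieIso (ModelRing θ) (Fin (p ^ 8)) :=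
    fun s => descendant_iff hp h5 hcard
  have hex : ∀ θ : Params p, ∃ _ : LieRing (Fin (p ^ 8)), IsLieIso (ModelRing θ) (Fin (p ^ 8)) := by
    intro θ
    have : Finite (ModelRing θ) :=
      Nat.finite_of_card_ne_zero (by rw [ModelRing.card hp]; exact pow_ne_zero _ hp.ne_zero)
    exact exists_lieRing_isLieIso
      (Finite.equivFinOfCardEq (ModelRing.card hp)).symm
  choose s hs using hex
  rw [← Params.card_isNormal hp]
  symm
  refine Nat.card_eq_of_bijective
    (fun θ => Quot.mk _ ⟨s θ.1, (hiff _).2 ⟨θ.1, θ.2, hs θ.1⟩⟩) ⟨?_, ?_⟩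
  · rintro ⟨θ, hθ⟩ ⟨θ', hθ'⟩ h
    have heqv : Equivalence (fun s t :
        {s : LieRing (Fin (p ^ 8)) //
          IsMaxClassDescendantOf p (presLie p {bab - ba4 - ba5, ba3b}) s} =>
      @IsLieIso _ _ s.1 t.1) :=
      ⟨fun s => ⟨Equiv.refl _, fun _ _ => rfl, fun _ _ => rfl⟩,
        fun {s t} h => @IsLieIso.symm _ _ s.1 t.1 h,
        fun {s t u} h h' => @IsLieIso.trans _ _ _ s.1 t.1 u.1 h h'⟩
    have h1 := heqv.eqvGen_iff.1 (Quot.eqvGen_exact h)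
    have h2 : IsLieIso (ModelRing θ') (ModelRing θ) :=
      @IsLieIso.trans _ _ _ _ (s θ') _ (hs θ')
        (@IsLieIso.trans _ _ _ (s θ') (s θ) _ (@IsLieIso.symm _ _ (s θ) (s θ') h1)
          (@IsLieIso.symm _ _ _ (s θ) (hs θ)))
    obtain ⟨e⟩ := isLieIso_iff.1 h2
    exact Subtype.ext (ModelRing.eq_of_isNormal hp h5 hθ hθ' e)
  · rintro ⟨t, ht⟩
    obtain ⟨θ, hθ, h⟩ := (hiff t).1 ht
    refine ⟨⟨θ, hθ⟩, Quot.sound ?_⟩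
    exact @IsLieIso.trans _ _ _ (s θ) _ t (@IsLieIso.symm _ _ _ (s θ) (hs θ)) h
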